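/- Fix an integer m ≥ 2, λ > 0, and a Borel probability measure μ₀ on ℝ. For t ≥ 0 let σ_t = Σ_{n≥1} e^{−(m−1)λt}(1−e^{−(m−1)λt})^{n−1} μ₀^{*(m−1)n}. Then each σ_t is a Borel probability measure on ℝ, and the family (σ_t) is the Wild-sum solution with initial condition μ₀^{*(m−1)} and rate (m−1)λ; that is, for every Borel set A ⊆ ℝ and t ≥ 0, σ_t(A) = μ₀^{*(m−1)}(A) + (m−1)λ ∫₀ᵗ ( (σ_s ∗ σ_s)(A) − σ_s(A) ) ds. -/

import Mathlib

open MeasureTheory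

/-- `n`-fold convolution power of a measure on `ℝ`: `convPow μ 0 = δ₀` and
`convPow μ (n+1) = (convPow μ n) ∗ μ`. In particular `convPow μ 1 = δ₀ ∗ μ = μ`. -/
noncomputable def convPow (μ : Measure ℝ) : ℕ → Measure ℝ
  | 0 => Measure.dirac 0
  | n + 1 => Measure.conv (convPow μ n) μ

/-- `σ_t = Σ_{n≥1} e^{−(m−1)λt}(1−e^{−(m−1)λt})^{n−1} μ₀^{*(m−1)n}`. -/
noncomputable def sigmaWild (m : ℕ) (μ₀ : Measure ℝ) (lam t : ℝ) : Measure ℝ :=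
  Measure.sum fun n : ℕ =>
    ENNReal.ofReal
        (Real.exp (-((m - 1 : ℕ) * lam * t)) *
          (1 - Real.exp (-((m - 1 : ℕ) * lam * t))) ^ n) •
      convPow μ₀ ((m - 1) * (n + 1))

theorem hasDerivAt_tsum_mul_pow {a : ℕ → ℝ} (ha : ∀ n, |a n| ≤ n + 1) {y : ℝ} (hy : |y| < 1) :
    HasDerivAt (fun z => ∑' n, a n * z ^ n) (∑' n : ℕ, (n + 1) * a (n + 1) * y ^ n) y := by
  obtain ⟨r, hyr, hr1⟩ := exists_between hy
  have hr0 : 0 < r := (abs_nonneg y).trans_lt hyr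
  have hr : ‖r‖ < 1 := by rwa [Real.norm_of_nonneg hr0.le]
  have hu : Summable fun n : ℕ => (n : ℝ) * (n + 1) * r ^ (n - 1) := by
    rw [← summable_nat_add_iff 1]
    have h0 := summable_pow_mul_geometric_of_norm_lt_one 0 hr
    have h1 := summable_pow_mul_geometric_of_norm_lt_one 1 hr
    have h2 := summable_pow_mul_geometric_of_norm_lt_one 2 hr
    refine ((h2.add (h1.mul_left 3)).add (h0.mul_left 2)).congr fun n => ?_
    simp only [Nat.add_sub_cancel]
    push_cast
    ring
  have hbound : ∀ n : ℕ, ∀ z ∈ Metric.ball (0 : ℝ) r,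
      ‖a n * (n * z ^ (n - 1))‖ ≤ (n : ℝ) * (n + 1) * r ^ (n - 1) := by
    intro n z hz
    have hz : |z| ≤ r := (mem_ball_zero_iff.1 hz).le
    rw [Real.norm_eq_abs, abs_mul, abs_mul, abs_pow, Nat.abs_cast]
    calc |a n| * (n * |z| ^ (n - 1)) ≤ (n + 1) * (n * r ^ (n - 1)) := by
          gcongr
          exact ha n
      _ = _ := by ring
  have hy_mem : y ∈ Metric.ball (0 : ℝ) r := mem_ball_zero_iff.2 hyr
  have hzero : Summable fun n => a n * (0 : ℝ) ^ n :=
    summable_of_ne_finset_zero (s := {0}) fun n hn => by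
      simp [zero_pow (by simpa using hn : n ≠ 0)]
  have h := hasDerivAt_tsum_of_isPreconnected hu Metric.isOpen_ball
    (convex_ball (0 : ℝ) r).isPreconnected
    (fun n z _ => (hasDerivAt_pow n z).const_mul (a n)) hbound
    (Metric.mem_ball_self hr0) hzero hy_mem
  refine h.congr_deriv ?_
  rw [(Summable.of_norm_bounded hu fun n => hbound n y hy_mem).tsum_eq_zero_add]
  simp only [Nat.cast_zero, zero_mul, mul_zero, zero_add, Nat.add_sub_cancel]
  refine tsum_congr fun n => ?_
  push_cast
  ring

instance isProbabilityMeasure_convPow (μ : Measure ℝ) [IsProbabilityMeasure μ] (n : ℕ) :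
    IsProbabilityMeasure (convPow μ n) := by
  induction n with
  | zero => exact Measure.dirac.isProbabilityMeasure
  | succ n ih => exact Measure.probabilitymeasure_of_probabilitymeasures_conv _ _

theorem convPow_add (μ : Measure ℝ) [IsProbabilityMeasure μ] (k n : ℕ) :
    convPow μ (k + n) = Measure.conv (convPow μ k) (convPow μ n) := by
  induction n with
  | zero => exact (Measure.conv_dirac_zero _).symm
  | succ n ih =>
    change Measure.conv (convPow μ (k + n)) μ = Measure.conv _ (Measure.conv (convPow μ n) μ)
    rw [ih, Measure.conv_assoc]

theorem conv_sum_smul_self_apply (c : ℕ → ENNReal) (ν : ℕ → Measure ℝ) [∀ n, SFinite (ν n)]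
    {A : Set ℝ} (hA : MeasurableSet A) :
    Measure.conv (Measure.sum fun n => c n • ν n) (Measure.sum fun n => c n • ν n) A =
      ∑' n, ∑ p ∈ Finset.HasAntidiagonal.antidiagonal n, c p.1 * c p.2 * Measure.conv (ν p.1) (ν p.2) A := by
  have hsum : Measure.conv (Measure.sum fun n => c n • ν n) (Measure.sum fun n => c n • ν n) A =
      ∑' p : ℕ × ℕ, c p.1 * c p.2 * Measure.conv (ν p.1) (ν p.2) A := by
    rw [Measure.conv, Measure.prod_sum, Measure.map_sum (by fun_prop), Measure.sum_apply _ hA]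
    refine tsum_congr fun p => ?_
    rw [Measure.prod_smul_left, Measure.prod_smul_right, Measure.map_smul, Measure.map_smul,
      Measure.smul_apply, Measure.smul_apply, smul_eq_mul, smul_eq_mul, Measure.conv, mul_assoc]
  rw [hsum, ← Finset.HasAntidiagonal.sigmaAntidiagonalEquivProd.tsum_eq, ENNReal.tsum_sigma']
  refine tsum_congr fun n => ?_
  rw [tsum_fintype]
  exact Finset.sum_coe_sort (Finset.HasAntidiagonal.antidiagonal n)
    fun p => c p.1 * c p.2 * Measure.conv (ν p.1) (ν p.2) A

section

variable (m : ℕ) (μ₀ : Measure ℝ) [IsProbabilityMeasure μ₀] {lam t : ℝ}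

theorem exp_neg_rate_le_one (hlam : 0 ≤ lam) (ht : 0 ≤ t) :
    Real.exp (-((m - 1 : ℕ) * lam * t)) ≤ 1 :=
  Real.exp_le_one_iff.2 (neg_nonpos.2 (by positivity))

theorem isProbabilityMeasure_sigmaWild (hlam : 0 ≤ lam) (ht : 0 ≤ t) :
    IsProbabilityMeasure (sigmaWild m μ₀ lam t) := by
  have hx1 := exp_neg_rate_le_one m hlam ht
  have hx0 := Real.exp_pos (-((m - 1 : ℕ) * lam * t))
  constructor
  rw [sigmaWild]
  set x := Real.exp (-((m - 1 : ℕ) * lam * t))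
  have hg := (hasSum_geometric_of_lt_one (sub_nonneg.2 hx1) (sub_lt_self 1 hx0)).mul_left x
  simp only [Measure.sum_apply _ MeasurableSet.univ, Measure.smul_apply, measure_univ, smul_eq_mul,
    mul_one]
  rw [← ENNReal.ofReal_tsum_of_nonneg
    (fun n => mul_nonneg hx0.le (pow_nonneg (sub_nonneg.2 hx1) n)) hg.summable, hg.tsum_eq,
    sub_sub_cancel, mul_inv_cancel₀ hx0.ne', ENNReal.ofReal_one]

theorem toReal_sigmaWild_apply (hlam : 0 ≤ lam) (ht : 0 ≤ t) {A : Set ℝ} (hA : MeasurableSet A) :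
    (sigmaWild m μ₀ lam t A).toReal =
      Real.exp (-((m - 1 : ℕ) * lam * t)) *
        ∑' n, (convPow μ₀ ((m - 1) * (n + 1)) A).toReal *
          (1 - Real.exp (-((m - 1 : ℕ) * lam * t))) ^ n := by
  have hx1 := exp_neg_rate_le_one m hlam ht
  have hx0 := Real.exp_pos (-((m - 1 : ℕ) * lam * t))
  rw [sigmaWild, Measure.sum_apply _ hA]
  set x := Real.exp (-((m - 1 : ℕ) * lam * t))
  simp only [Measure.smul_apply, smul_eq_mul]
  rw [ENNReal.tsum_toReal_eq
    fun n => ENNReal.mul_ne_top ENNReal.ofReal_ne_top (measure_ne_top _ _), ← tsum_mul_left]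
  refine tsum_congr fun n => ?_
  rw [ENNReal.toReal_mul,
    ENNReal.toReal_ofReal (mul_nonneg hx0.le (pow_nonneg (sub_nonneg.2 hx1) n))]
  ring

theorem toReal_conv_sigmaWild_self_apply (hlam : 0 ≤ lam) (ht : 0 ≤ t) {A : Set ℝ}
    (hA : MeasurableSet A) :
    (Measure.conv (sigmaWild m μ₀ lam t) (sigmaWild m μ₀ lam t) A).toReal =
      Real.exp (-((m - 1 : ℕ) * lam * t)) ^ 2 *
        ∑' n : ℕ, (n + 1) * (convPow μ₀ ((m - 1) * (n + 1 + 1)) A).toReal *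
          (1 - Real.exp (-((m - 1 : ℕ) * lam * t))) ^ n := by
  have hx1 := exp_neg_rate_le_one m hlam ht
  have hx0 := Real.exp_pos (-((m - 1 : ℕ) * lam * t))
  rw [sigmaWild, conv_sum_smul_self_apply _ _ hA]
  set x := Real.exp (-((m - 1 : ℕ) * lam * t))
  have hterm : ∀ n : ℕ, ∑ p ∈ Finset.HasAntidiagonal.antidiagonal n,
      ENNReal.ofReal (x * (1 - x) ^ p.1) * ENNReal.ofReal (x * (1 - x) ^ p.2) *
        Measure.conv (convPow μ₀ ((m - 1) * (p.1 + 1))) (convPow μ₀ ((m - 1) * (p.2 + 1))) A =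
      (n + 1 : ℕ) * (ENNReal.ofReal (x ^ 2 * (1 - x) ^ n) *
        convPow μ₀ ((m - 1) * (n + 1 + 1)) A) := by
    intro n
    refine (Finset.sum_eq_card_nsmul fun p hp => ?_).trans
      (by rw [Finset.Nat.card_antidiagonal, nsmul_eq_mul])
    have hp : p.1 + p.2 = n := Finset.HasAntidiagonal.mem_antidiagonal.1 hp
    rw [← convPow_add, ← mul_add,
      ← ENNReal.ofReal_mul (mul_nonneg hx0.le (pow_nonneg (sub_nonneg.2 hx1) _)), ← hp]
    congr 2
    · ring
    · ring_nf
  simp only [hterm]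
  rw [ENNReal.tsum_toReal_eq fun n => ENNReal.mul_ne_top (ENNReal.natCast_ne_top _)
    (ENNReal.mul_ne_top ENNReal.ofReal_ne_top (measure_ne_top _ _)), ← tsum_mul_left]
  refine tsum_congr fun n => ?_
  rw [ENNReal.toReal_mul, ENNReal.toReal_mul, ENNReal.toReal_natCast,
    ENNReal.toReal_ofReal (mul_nonneg (sq_nonneg x) (pow_nonneg (sub_nonneg.2 hx1) n))]
  push_cast
  ring

end

/-- If `G` is a power series on the unit disc with bounded coefficients, then
`t ↦ e^{-ct} G(1 - e^{-ct})` satisfies the integrated form of `F' = c (x² G'(1 - x) - F)`,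
where `x = e^{-ct}`. -/
theorem exp_mul_tsum_eq_add_integral {a : ℕ → ℝ} (ha : ∀ n, |a n| ≤ 1) {c t : ℝ} (hc : 0 ≤ c)
    (ht : 0 ≤ t) :
    Real.exp (-(c * t)) * ∑' n, a n * (1 - Real.exp (-(c * t))) ^ n =
      a 0 + c * ∫ s in (0 : ℝ)..t,
        (Real.exp (-(c * s)) ^ 2 *
            ∑' n : ℕ, (n + 1) * a (n + 1) * (1 - Real.exp (-(c * s))) ^ n -
          Real.exp (-(c * s)) * ∑' n, a n * (1 - Real.exp (-(c * s))) ^ n) := by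
  have ha' : ∀ n : ℕ, |a n| ≤ n + 1 := fun n => (ha n).trans (by simp)
  have hb : ∀ n : ℕ, |(n + 1) * a (n + 1)| ≤ n + 1 := fun n => by
    rw [abs_mul, abs_of_nonneg (by positivity : (0 : ℝ) ≤ n + 1)]
    exact mul_le_of_le_one_right (by positivity) (ha _)
  have hy : ∀ s ∈ Set.uIcc 0 t, |1 - Real.exp (-(c * s))| < 1 := by
    intro s hs
    rw [Set.uIcc_of_le ht] at hs
    have h0 := Real.exp_pos (-(c * s))
    have h1 : Real.exp (-(c * s)) ≤ 1 :=
      Real.exp_le_one_iff.2 (neg_nonpos.2 (mul_nonneg hc hs.1))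
    rw [abs_lt]
    constructor <;> linarith
  have hx : ∀ s : ℝ, HasDerivAt (fun s => Real.exp (-(c * s))) (Real.exp (-(c * s)) * -c) s :=
    fun s => by simpa using (((hasDerivAt_id s).const_mul c).neg).exp
  have hG : ∀ s ∈ Set.uIcc 0 t,
      HasDerivAt (fun s => ∑' n, a n * (1 - Real.exp (-(c * s))) ^ n)
        ((∑' n : ℕ, (n + 1) * a (n + 1) * (1 - Real.exp (-(c * s))) ^ n) *
          -(Real.exp (-(c * s)) * -c)) s :=
    fun s hs => HasDerivAt.comp (h₂ := fun z => ∑' n, a n * z ^ n) s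
      (hasDerivAt_tsum_mul_pow ha' (hy s hs)) ((hx s).const_sub 1)
  have hG' : ContinuousOn
      (fun s => ∑' n : ℕ, (n + 1) * a (n + 1) * (1 - Real.exp (-(c * s))) ^ n)
      (Set.uIcc 0 t) := fun s hs =>
    ((hasDerivAt_tsum_mul_pow hb (hy s hs)).continuousAt.comp
      (f := fun s => 1 - Real.exp (-(c * s))) (by fun_prop)).continuousWithinAt
  have hGc : ContinuousOn (fun s => ∑' n, a n * (1 - Real.exp (-(c * s))) ^ n) (Set.uIcc 0 t) :=
    fun s hs => (hG s hs).continuousAt.continuousWithinAt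
  have hftc := intervalIntegral.integral_eq_sub_of_hasDerivAt
    (f := fun s => Real.exp (-(c * s)) * ∑' n, a n * (1 - Real.exp (-(c * s))) ^ n)
    (f' := fun s => c * (Real.exp (-(c * s)) ^ 2 *
            ∑' n : ℕ, (n + 1) * a (n + 1) * (1 - Real.exp (-(c * s))) ^ n -
          Real.exp (-(c * s)) * ∑' n, a n * (1 - Real.exp (-(c * s))) ^ n))
    (a := 0) (b := t)
    (fun s hs => ((hx s).mul (hG s hs)).congr_deriv (by ring))
    (ContinuousOn.intervalIntegrable (by fun_prop))
  have hzero : ∑' n, a n * (0 : ℝ) ^ n = a 0 := by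
    rw [tsum_eq_single 0 fun n hn => by simp [hn]]
    simp
  rw [intervalIntegral.integral_const_mul] at hftc
  rw [hftc]
  simp [hzero]

/-- Each `σ_t` is a Borel probability measure on `ℝ`, and `(σ_t)` is
the Wild-sum solution with initial condition `μ₀^{*(m−1)}` and rate `(m−1)λ`:
`σ_t(A) = μ₀^{*(m−1)}(A) + (m−1)λ ∫₀ᵗ ((σ_s ∗ σ_s)(A) − σ_s(A)) ds`. -/
theorem sigmaWild_isProbability_and_solves_evolution
    (m : ℕ) (hm : 2 ≤ m) (lam : ℝ) (hlam : 0 < lam)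
    (μ₀ : Measure ℝ) [IsProbabilityMeasure μ₀] :
    (∀ t ≥ (0 : ℝ), IsProbabilityMeasure (sigmaWild m μ₀ lam t)) ∧
    (∀ A : Set ℝ, MeasurableSet A → ∀ t ≥ (0 : ℝ),
      ((sigmaWild m μ₀ lam t) A).toReal =
        ((convPow μ₀ (m - 1)) A).toReal +
          ((m - 1 : ℕ) * lam) * ∫ s in (0 : ℝ)..t,
            ((Measure.conv (sigmaWild m μ₀ lam s) (sigmaWild m μ₀ lam s)) A).toReal -
              ((sigmaWild m μ₀ lam s) A).toReal) := by
  refine ⟨fun t ht => isProbabilityMeasure_sigmaWild m μ₀ hlam.le ht, fun A hA t ht => ?_⟩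
  rw [toReal_sigmaWild_apply m μ₀ hlam.le ht hA,
    exp_mul_tsum_eq_add_integral (c := (m - 1 : ℕ) * lam)
      (fun n => (abs_of_nonneg ENNReal.toReal_nonneg).trans_le
        (measureReal_le_one (μ := convPow μ₀ ((m - 1) * (n + 1))) (s := A)))
      (by positivity) ht, zero_add, mul_one]
  congr 2
  refine intervalIntegral.integral_congr fun s hs => ?_
  rw [Set.uIcc_of_le ht] at hs
  exact congrArg₂ (· - ·) (toReal_conv_sigmaWild_self_apply m μ₀ hlam.le hs.1 hA).symm
    (toReal_sigmaWild_apply m μ₀ hlam.le hs.1 hA).symm
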